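/- arXiv:2401.15946 — 3 statements merged into one kernel-verified Lean document; each statement's English description precedes it below -/
import Mathlib

section
/- Fix n a positive integer and ℓ ∈ ℝⁿ. For an error pattern e ∈ F₂ⁿ define s(e) = ∏_{i : e_i = 1} 1/(1+exp(|ℓ_i|)) · ∏_{i : e_i = 0} exp(|ℓ_i|)/(1+exp(|ℓ_i|)). Then for any two error patterns e, e' ∈ F₂ⁿ: s(e) ≥ s(e') if and only if Σ_{i : e_i = 1} |ℓ_i| ≤ Σ_{i : e'_i = 1} |ℓ_i|. -/
open Finset

/-- The posterior probability `s(e)` of an error pattern `e` given LLR magnitudes `|ℓ_i|`. -/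
noncomputable def sPost {n : ℕ} (ℓ : Fin n → ℝ) (e : Fin n → ZMod 2) : ℝ :=
  (∏ i ∈ univ.filter (fun i => e i = 1), 1 / (1 + Real.exp |ℓ i|)) *
    (∏ i ∈ univ.filter (fun i => e i = 0), Real.exp |ℓ i| / (1 + Real.exp |ℓ i|))

theorem sPost_eq_aux {n : ℕ} (ℓ : Fin n → ℝ) (e : Fin n → ZMod 2) :
    sPost ℓ e = (∏ i, Real.exp |ℓ i| / (1 + Real.exp |ℓ i|)) *
      Real.exp (-∑ i ∈ univ.filter (fun i => e i = 1), |ℓ i|) := by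
  have h01 : ∀ x : ZMod 2, x = 0 ↔ ¬ x = 1 := by decide
  have h0 : (univ.filter (fun i => e i = 0)) = univ.filter (fun i => ¬ e i = 1) :=
    Finset.filter_congr (fun i _ => h01 (e i))
  unfold sPost
  rw [h0, ← Finset.prod_filter_mul_prod_filter_not univ (fun i => e i = 1)
    (fun i => Real.exp |ℓ i| / (1 + Real.exp |ℓ i|)), ← Finset.sum_neg_distrib, Real.exp_sum,
    mul_right_comm, ← Finset.prod_mul_distrib]
  congr 1
  refine Finset.prod_congr rfl (fun i _ => ?_)
  rw [div_mul_eq_mul_div, ← Real.exp_add, add_neg_cancel, Real.exp_zero]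

/-- Core claim of Proposition 1: ordering error patterns by decreasing posterior `s` is the
same as ordering them by increasing accumulated reliability `Σ_{i : e_i = 1} |ℓ_i|`. -/
theorem posterior_ge_iff_reliability_le {n : ℕ} (hn : 0 < n) (ℓ : Fin n → ℝ)
    (e e' : Fin n → ZMod 2) :
    sPost ℓ e' ≤ sPost ℓ e ↔
      ∑ i ∈ univ.filter (fun i => e i = 1), |ℓ i| ≤
        ∑ i ∈ univ.filter (fun i => e' i = 1), |ℓ i| := by
  have hC : 0 < ∏ i, Real.exp |ℓ i| / (1 + Real.exp |ℓ i|) :=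
    Finset.prod_pos (fun i _ => by positivity)
  rw [sPost_eq_aux, sPost_eq_aux, mul_le_mul_iff_right₀ hC, Real.exp_le_exp, neg_le_neg_iff]
end

section
/- Let N be a positive integer and let S : {1, …, N} → ℝ be injective. Let σ be the (unique) permutation of {1, …, N} such that the rearranged sequence Ŝ_t = S(σ(t)) is strictly decreasing: Ŝ_1 > Ŝ_2 > … > Ŝ_N. Then Σ_{t=1}^{N} t · (S(t) − Ŝ_t) = Σ_{1 ≤ i < j ≤ N, S(i) < S(j)} (S(j) − S(i)). -/
open Finset in
/-- Pointwise identity underlying Proposition 2: for injective `S : {1,…,N} → ℝ` (indexed by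
`Fin N`, query `t` having weight `t+1`) and `σ` the permutation sorting `S` into the strictly
decreasing rearrangement `Ŝ_t = S(σ(t))`, the excess weighted sum `Σ_t t·(S(t) − Ŝ_t)` equals
the sum of `S(j) − S(i)` over all out-of-order pairs `i < j` with `S(i) < S(j)`. -/
theorem excess_weighted_sum_eq_out_of_order_pairs {N : ℕ} (hN : 0 < N) (S : Fin N → ℝ)
    (hinj : Function.Injective S) (σ : Equiv.Perm (Fin N))
    (hσ : StrictAnti (fun t => S (σ t))) :
    ∑ t : Fin N, ((t : ℕ) + 1 : ℝ) * (S t - S (σ t)) =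
      ∑ i : Fin N, ∑ j : Fin N,
        if i < j ∧ S i < S j then S j - S i else 0 := by
  have hcard : ∀ t : Fin N, ((t : ℕ) : ℝ) = ∑ i : Fin N, if i < t then (1 : ℝ) else 0 := by
    intro t
    rw [Finset.sum_boole]
    have : (Finset.univ.filter (fun i : Fin N => i < t)) = Finset.Iio t := by
      ext i
      simp
    rw [this, Fin.card_Iio]
  have h1 : ∑ t : Fin N, ((t : ℕ) : ℝ) * S t
      = ∑ i : Fin N, ∑ j : Fin N, if i < j then S j else 0 := by
    rw [Finset.sum_comm]
    refine Finset.sum_congr rfl fun t _ => ?_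
    rw [hcard t, Finset.sum_mul]
    simp
  have h2 : ∑ t : Fin N, ((t : ℕ) : ℝ) * S (σ t)
      = ∑ i : Fin N, ∑ j : Fin N, if S j < S i then S j else 0 := by
    rw [Finset.sum_comm, ← Equiv.sum_comp σ (fun j => ∑ i : Fin N, if S j < S i then S j else 0)]
    refine Finset.sum_congr rfl fun t _ => ?_
    rw [← Equiv.sum_comp σ (fun i => if S (σ t) < S i then S (σ t) else 0), hcard t, Finset.sum_mul]
    refine Finset.sum_congr rfl fun i _ => ?_
    have : S (σ t) < S (σ i) ↔ i < t := hσ.lt_iff_gt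
    simp [this]
  have h3 : ∑ t : Fin N, S (σ t) = ∑ t : Fin N, S t := Equiv.sum_comp σ S
  have hL : ∑ t : Fin N, ((t : ℕ) + 1 : ℝ) * (S t - S (σ t))
      = ∑ i : Fin N, ∑ j : Fin N,
        ((if i < j then S j else 0) - (if S j < S i then S j else 0)) := by
    simp only [Finset.sum_sub_distrib]
    rw [← h1, ← h2]
    have : ∀ t : Fin N, ((t : ℕ) + 1 : ℝ) * (S t - S (σ t))
      = ((t : ℕ) : ℝ) * S t - ((t : ℕ) : ℝ) * S (σ t) + (S t - S (σ t)) := fun t => by ring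
    simp only [this, Finset.sum_add_distrib, Finset.sum_sub_distrib, h3]
    ring
  rw [hL]
  have key : ∀ f g : Fin N → Fin N → ℝ, (∀ i j, f i j + f j i = g i j + g j i) →
      ∑ i, ∑ j, f i j = ∑ i, ∑ j, g i j := by
    intro f g h
    have hf := Finset.sum_comm (s := univ) (t := univ) (f := f)
    have hg := Finset.sum_comm (s := univ) (t := univ) (f := g)
    have : ∑ i, ∑ j, (f i j + f j i) = ∑ i, ∑ j, (g i j + g j i) := by simp only [h]
    simp only [Finset.sum_add_distrib] at this
    linarith
  apply key
  intro i j
  rcases lt_trichotomy i j with h | h | h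
  · rcases lt_or_gt_of_ne (hinj.ne h.ne) with h' | h' <;>
      simp [h, h', h.not_gt, h'.not_gt] <;> ring
  · subst h
    simp
  · rcases lt_or_gt_of_ne (hinj.ne h.ne) with h' | h' <;>
      simp [h, h', h.not_gt, h'.not_gt] <;> ring
end

section
/- Let N be a positive integer, let (Ω, F, P) be a probability space, and let S_1, …, S_N : Ω → ℝ be integrable random variables such that almost surely the values S_1(ω), …, S_N(ω) are pairwise distinct. For each ω let Ŝ_t(ω) denote the t-th largest value among S_1(ω), …, S_N(ω), so that Ŝ_1 ≥ Ŝ_2 ≥ … ≥ Ŝ_N pointwise. Then Σ_{t=1}^{N} t · E[S_t − Ŝ_t] = Σ_{1 ≤ i < j ≤ N} E[ (S_j − S_i) · 1{S_j > S_i} ]. -/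
open MeasureTheory Finset

lemma excess_aux {N : ℕ} (a : Fin N → ℝ) :
    ∑ i : Fin N, ∑ j : Fin N, (if i < j then max (a j - a i) 0 else 0) =
      ∑ t : Fin N, ((t : ℕ) + 1 : ℝ) * a t +
      ((∑ i : Fin N, ∑ j : Fin N, |a j - a i|) / 4 - ((N : ℝ) + 1) / 2 * ∑ t, a t) := by
  have h1 : ∑ i : Fin N, ∑ j : Fin N, (if i < j then |a j - a i| else 0) =
      (∑ i : Fin N, ∑ j : Fin N, |a j - a i|) / 2 := by
    have h2 : ∑ i : Fin N, ∑ j : Fin N, (if i < j then |a j - a i| else 0) =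
        ∑ i : Fin N, ∑ j : Fin N, (if j < i then |a j - a i| else 0) := by
      rw [Finset.sum_comm]
      simp only [abs_sub_comm]
    have h3 : ∑ i : Fin N, ∑ j : Fin N, |a j - a i| =
        ∑ i : Fin N, ∑ j : Fin N, (if i < j then |a j - a i| else 0) +
        ∑ i : Fin N, ∑ j : Fin N, (if j < i then |a j - a i| else 0) := by
      simp only [← Finset.sum_add_distrib]
      refine Finset.sum_congr rfl fun i _ => Finset.sum_congr rfl fun j _ => ?_
      rcases lt_trichotomy i j with h | h | h
      · simp [h, h.not_gt]
      · simp [h]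
      · simp [h, h.not_gt]
    linarith
  have h4 : ∑ i : Fin N, ∑ j : Fin N, (if i < j then a j else 0) =
      ∑ t : Fin N, (t : ℕ) * a t := by
    rw [Finset.sum_comm]
    refine Finset.sum_congr rfl fun j _ => ?_
    rw [← Finset.sum_filter, Finset.sum_const, Finset.filter_gt_eq_Iio, Fin.card_Iio, nsmul_eq_mul]
  have h5 : ∑ i : Fin N, ∑ j : Fin N, (if i < j then a i else 0) =
      ∑ t : Fin N, ((N : ℝ) - 1 - (t : ℕ)) * a t := by
    refine Finset.sum_congr rfl fun i _ => ?_
    rw [← Finset.sum_filter, Finset.sum_const, Finset.filter_lt_eq_Ioi, Fin.card_Ioi, nsmul_eq_mul]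
    congr 1
    have := i.2
    rw [Nat.sub_sub, Nat.cast_sub (by omega)]
    push_cast; ring
  have h6 : ∑ i : Fin N, ∑ j : Fin N, (if i < j then max (a j - a i) 0 else 0) =
      (∑ i : Fin N, ∑ j : Fin N, (if i < j then a j else 0) -
      ∑ i : Fin N, ∑ j : Fin N, (if i < j then a i else 0) +
      ∑ i : Fin N, ∑ j : Fin N, (if i < j then |a j - a i| else 0)) / 2 := by
    simp only [← Finset.sum_add_distrib, ← Finset.sum_sub_distrib, Finset.sum_div]
    refine Finset.sum_congr rfl fun i _ => Finset.sum_congr rfl fun j _ => ?_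
    split_ifs
    · rcases le_total (a j - a i) 0 with h | h
      · rw [max_eq_right h, abs_of_nonpos h]; ring
      · rw [max_eq_left h, abs_of_nonneg h]; ring
    · simp
  rw [h6, h1, h4, h5, ← Finset.sum_sub_distrib, Finset.mul_sum]
  have h7 : ∑ t : Fin N, ((t : ℕ) + 1 : ℝ) * a t - ∑ t : Fin N, ((N : ℝ) + 1) / 2 * a t =
    (∑ t : Fin N, (((t : ℕ) : ℝ) * a t - ((N : ℝ) - 1 - (t : ℕ)) * a t)) / 2 := by
    rw [← Finset.sum_sub_distrib, Finset.sum_div]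
    refine Finset.sum_congr rfl fun i _ => ?_
    ring
  linarith

lemma excess_pointwise {N : ℕ} (a b : Fin N → ℝ) (e : Equiv.Perm (Fin N))
    (h : ∀ t, b t = a (e t)) (hb : Antitone b) :
    ∑ t : Fin N, ((t : ℕ) + 1 : ℝ) * (a t - b t) =
    ∑ i : Fin N, ∑ j : Fin N, (if i < j then max (a j - a i) 0 else 0) := by
  have ha := excess_aux a
  have hb' := excess_aux b
  have h0 : ∑ i : Fin N, ∑ j : Fin N, (if i < j then max (b j - b i) 0 else 0) = 0 := by
    refine Finset.sum_eq_zero fun i _ => Finset.sum_eq_zero fun j _ => ?_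
    split_ifs with hij
    · exact max_eq_right (by linarith [hb hij.le])
    · rfl
  have h1 : ∑ t, b t = ∑ t, a t := by
    simp only [h]; exact Equiv.sum_comp e a
  have h2 : ∑ i : Fin N, ∑ j : Fin N, |b j - b i| = ∑ i : Fin N, ∑ j : Fin N, |a j - a i| := by
    simp only [h]
    rw [← Equiv.sum_comp e (fun i => ∑ j : Fin N, |a j - a i|)]
    exact Finset.sum_congr rfl fun i _ => Equiv.sum_comp e (fun j => |a j - a (e i)|)
  rw [h0, h1, h2] at hb'
  simp only [mul_sub, Finset.sum_sub_distrib]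
  linarith

lemma shat_integrable {N : ℕ} {Ω : Type*} [MeasurableSpace Ω]
    (μ : Measure Ω)
    (S : Fin N → Ω → ℝ) (hint : ∀ t, Integrable (S t) μ)
    (Shat : Fin N → Ω → ℝ)
    (hperm : ∀ ω, ∃ e : Equiv.Perm (Fin N), ∀ t, Shat t ω = S (e t) ω)
    (hsorted : ∀ ω, Antitone (fun t => Shat t ω)) (t : Fin N) : Integrable (Shat t) μ := by
  let A : Equiv.Perm (Fin N) → Set Ω := fun e => ⋂ i, ⋂ j, ⋂ (_ : i ≤ j),
    {ω | S (e j) ω ≤ S (e i) ω}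
  have hA : ∀ e, NullMeasurableSet (A e) μ := fun e =>
    NullMeasurableSet.iInter fun i => NullMeasurableSet.iInter fun j =>
      NullMeasurableSet.iInter fun _ =>
        nullMeasurableSet_le (hint _).aemeasurable (hint _).aemeasurable
  have hU : (⋃ e, A e) = Set.univ := by
    refine Set.eq_univ_of_forall fun ω => ?_
    obtain ⟨e, he⟩ := hperm ω
    simp only [A, Set.mem_iUnion, Set.mem_iInter, Set.mem_ofPred_eq]
    refine ⟨e, fun i j hij => ?_⟩
    rw [← he, ← he]
    exact hsorted ω hij
  have hm : AEMeasurable (Shat t) μ := by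
    rw [← Measure.restrict_univ (μ := μ), ← hU, aemeasurable_iUnion_iff]
    intro e
    refine (hint (e t)).aemeasurable.restrict.congr ?_
    refine (ae_restrict_iff'₀ (hA e)).2 (Filter.Eventually.of_forall fun ω hω => ?_)
    obtain ⟨e', he'⟩ := hperm ω
    simp only [A, Set.mem_iInter, Set.mem_ofPred_eq] at hω
    have := Tuple.unique_monotone (f := fun i => - S i ω) (σ := e) (τ := e')
      (fun i j hij => neg_le_neg (hω i j hij))
      (fun i j hij => neg_le_neg (by rw [← he', ← he']; exact hsorted ω hij))
    have := congrFun this t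
    simp only [Function.comp, neg_inj] at this
    rw [he', this]
  refine (integrable_finsetSum Finset.univ fun i _ => (hint i).norm).mono'
    hm.aestronglyMeasurable (Filter.Eventually.of_forall fun ω => ?_)
  obtain ⟨e, he⟩ := hperm ω
  rw [he]
  exact Finset.single_le_sum (f := fun i => ‖S i ω‖) (fun i _ => norm_nonneg _) (Finset.mem_univ (e t))


/-- Proposition 2 of the paper: let `S_1, …, S_N` (indexed by `Fin N`, query `t` having
weight `t+1`) be integrable posteriors which are a.s. pairwise distinct, and let `Ŝ_t` be
the `t`-th largest value among `S_1(ω), …, S_N(ω)` (i.e. for each `ω`, `t ↦ Ŝ_t(ω)` is a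
non-increasing rearrangement of `t ↦ S_t(ω)`). Then the expected excess number of queries
satisfies `Σ_t t·E[S_t − Ŝ_t] = Σ_{i<j} E[(S_j − S_i)·1{S_j > S_i}]`. -/
theorem expected_excess_queries {N : ℕ} (hN : 0 < N) {Ω : Type*} [MeasurableSpace Ω]
    (μ : Measure Ω) [IsProbabilityMeasure μ]
    (S : Fin N → Ω → ℝ) (hint : ∀ t, Integrable (S t) μ)
    (hdist : ∀ᵐ ω ∂μ, ∀ i j : Fin N, i ≠ j → S i ω ≠ S j ω)
    (Shat : Fin N → Ω → ℝ)
    (hperm : ∀ ω, ∃ e : Equiv.Perm (Fin N), ∀ t, Shat t ω = S (e t) ω)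
    (hsorted : ∀ ω, Antitone (fun t => Shat t ω)) :
    ∑ t : Fin N, ((t : ℕ) + 1 : ℝ) * ∫ ω, (S t ω - Shat t ω) ∂μ =
      ∑ i : Fin N, ∑ j : Fin N,
        if i < j then
          ∫ ω, Set.indicator {ω' | S i ω' < S j ω'} (fun ω' => S j ω' - S i ω') ω ∂μ
        else 0 := by

  have hS := shat_integrable μ S hint Shat hperm hsorted
  have hind : ∀ i j ω, Set.indicator {ω' | S i ω' < S j ω'} (fun ω' => S j ω' - S i ω') ω =
      max (S j ω - S i ω) 0 := by
    intro i j ω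
    by_cases h : S i ω < S j ω
    · rw [Set.indicator_of_mem (by exact h), max_eq_left (by linarith)]
    · rw [Set.indicator_of_notMem (by exact h), max_eq_right (by linarith)]
  simp only [hind]
  have hmx : ∀ i j, Integrable (fun ω => if i < j then max (S j ω - S i ω) 0 else 0) μ := by
    intro i j
    split_ifs
    · exact ((hint j).sub (hint i)).pos_part
    · exact integrable_zero _ _ _
  calc _ = ∫ ω, ∑ t : Fin N, ((t : ℕ) + 1 : ℝ) * (S t ω - Shat t ω) ∂μ := by
        rw [integral_finsetSum]
        · simp only [integral_const_mul]
        · exact fun t _ => ((hint t).sub (hS t)).const_mul _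
    _ = ∫ ω, ∑ i : Fin N, ∑ j : Fin N, (if i < j then max (S j ω - S i ω) 0 else 0) ∂μ := by
        refine integral_congr_ae (Filter.Eventually.of_forall fun ω => ?_)
        obtain ⟨e, he⟩ := hperm ω
        exact excess_pointwise (fun t => S t ω) (fun t => Shat t ω) e he (hsorted ω)
    _ = _ := by
        rw [integral_finsetSum _ fun i _ => integrable_finsetSum _ fun j _ => hmx i j]
        refine Finset.sum_congr rfl fun i _ => ?_
        rw [integral_finsetSum _ fun j _ => hmx i j]
        refine Finset.sum_congr rfl fun j _ => ?_
        split_ifs <;> simp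
end
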